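/- arXiv:2112.11616 — 2 statements merged into one kernel-verified Lean document; each statement's English description precedes it below -/
import Mathlib

section
/- Let M be a finite index set, and for each m ∈ M let α_m ≤ β_m be reals; let D = Π_{m∈M} [α_m, β_m] ⊂ ℝ^M be the closed rectangle, with faces D_m^- = {θ ∈ D : θ_m = α_m} and D_m^+ = {θ ∈ D : θ_m = β_m}. Let η_m : D → ℝ be continuous for each m ∈ M, let Λ_m > 0 for each m ∈ M, and let A_m, B_m ∈ ℝ satisfy η_m(θ) ≥ A_m for all θ ∈ D_m^- and η_m(θ) ≤ B_m for all θ ∈ D_m^+. Then for every μ ∈ ℝ^M such that B_m − β_m/Λ_m ≤ μ_m ≤ A_m − α_m/Λ_m for all m ∈ M, there exists θ ∈ D such that θ_m = Λ_m(η_m(θ) − μ_m) for every m ∈ M. -/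
/-- The `k`-th vertex of the simplex of the Freudenthal triangulation of `ℤⁿ` with initial vertex
`x` in which direction `i` is traversed at step `σ i`. -/
def freudenthalVertex {n : ℕ} (x : Fin n → ℤ) (σ : Equiv.Perm (Fin n)) (k : Fin (n + 1)) :
    Fin n → ℤ :=
  fun i => x i + if (σ i : ℕ) < k then 1 else 0

/-- The integer points of the half-open cube `[0, N)ⁿ`. -/
noncomputable def gridBox (n N : ℕ) : Finset (Fin n → ℤ) :=
  Fintype.piFinset fun _ => Finset.Ico 0 (N : ℤ)

lemma mem_gridBox {n N : ℕ} {x : Fin n → ℤ} : x ∈ gridBox n N ↔ ∀ i, 0 ≤ x i ∧ x i < N := by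
  simp [gridBox]

lemma sum_sign_inner_facet_eq_zero {m : ℕ} (Φ : (Fin (m + 1) → Fin (m + 1) → ℤ) → ℤ)
    (x : Fin (m + 1) → ℤ) (l : Fin m) :
    ∑ σ : Equiv.Perm (Fin (m + 1)), (Equiv.Perm.sign σ : ℤ) *
      Φ (fun k => freudenthalVertex x σ (l.castSucc.succ.succAbove k)) = 0 := by
  set τ := Equiv.swap l.castSucc l.succ with hτ
  have hne : l.castSucc ≠ l.succ := by simp [Fin.ext_iff]
  have key : ∀ σ : Equiv.Perm (Fin (m + 1)), ∀ k,
      freudenthalVertex x (τ * σ) (l.castSucc.succ.succAbove k) =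
        freudenthalVertex x σ (l.castSucc.succ.succAbove k) := by
    intro σ k
    have hk := Fin.succAbove_ne l.castSucc.succ k
    generalize l.castSucc.succ.succAbove k = r at hk
    have hr : (r : ℕ) ≠ l + 1 := fun h => hk (by ext; simpa using h)
    ext i
    simp only [freudenthalVertex, Equiv.Perm.mul_apply, hτ, Equiv.swap_apply_def]
    congr 1
    split_ifs with h1 h2 <;> simp_all [Fin.ext_iff] <;> omega
  have h := Equiv.sum_comp (Equiv.mulLeft τ) fun σ : Equiv.Perm (Fin (m + 1)) =>
    (Equiv.Perm.sign σ : ℤ) * Φ (fun k => freudenthalVertex x σ (l.castSucc.succ.succAbove k))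
  simp only [Equiv.coe_mulLeft, key, Equiv.Perm.sign_mul] at h
  simp only [hτ, Equiv.Perm.sign_swap hne, neg_mul, one_mul, Units.val_neg,
    Finset.sum_neg_distrib] at h
  linarith

lemma freudenthalVertex_rotate {m : ℕ} (x : Fin (m + 1) → ℤ) (σ : Equiv.Perm (Fin (m + 1)))
    (k : Fin (m + 1)) :
    freudenthalVertex x ((finRotate (m + 1)).symm * σ) k.castSucc =
      freudenthalVertex (x - Pi.single (σ.symm 0) 1) σ k.succ := by
  ext i
  obtain ⟨a, rfl⟩ := σ.symm.surjective i
  simp only [freudenthalVertex, Equiv.Perm.mul_apply, Equiv.apply_symm_apply, Pi.sub_apply]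
  refine Fin.cases ?_ (fun b => ?_) a
  · have : (finRotate (m + 1)).symm 0 = Fin.last m := by
      rw [Equiv.symm_apply_eq, finRotate_last]
    have hk := k.2
    simp [this, show ¬ m < (k : ℕ) by omega]
  · have : (finRotate (m + 1)).symm b.succ = b.castSucc := by
      rw [Equiv.symm_apply_eq, finRotate_apply, Fin.coeSucc_eq_succ]
    simp [this]

lemma sum_gridBox_sub_single {n N : ℕ} (j : Fin n) (h : (Fin n → ℤ) → ℤ)
    (h0 : ∀ x, x j = -1 → h x = 0) (hN : ∀ x, x j + 1 = (N : ℤ) → h x = 0) :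
    ∑ x ∈ gridBox n N, h (x - Pi.single j 1) = ∑ x ∈ gridBox n N, h x := by
  refine Finset.sum_bij_ne_zero (fun x _ _ => x - Pi.single j 1) ?_ ?_ ?_ ?_
  · intro x hx hne
    rw [mem_gridBox] at hx ⊢
    intro i
    rcases eq_or_ne i j with rfl | hij
    · have h1 : x i - 1 ≠ -1 := fun h' => hne (h0 _ (by simpa using h'))
      have := hx i
      simp only [Pi.sub_apply, Pi.single_eq_same]
      omega
    · simpa [hij] using hx i
  · intro x _ _ y _ _ hxy
    exact sub_left_injective hxy
  · intro y hy hne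
    refine ⟨y + Pi.single j 1, ?_, by simpa using hne, by simp⟩
    rw [mem_gridBox] at hy ⊢
    intro i
    rcases eq_or_ne i j with rfl | hij
    · have h1 : y i + 1 ≠ N := fun h' => hne (hN _ h')
      have := hy i
      simp only [Pi.add_apply, Pi.single_eq_same]
      omega
    · simpa [hij] using hy i
  · intros; rfl

/-- A discrete Stokes theorem for the triangulated cube `[0, N]ⁿ`: a facet function vanishing on
the facets inside the boundary of the cube has zero total coboundary. -/
lemma sum_coboundary_eq_zero {m N : ℕ} (Φ : (Fin (m + 1) → Fin (m + 1) → ℤ) → ℤ)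
    (hΦ : ∀ y j, ((∀ l, y l j = 0) ∨ (∀ l, y l j = (N : ℤ))) → Φ y = 0) :
    ∑ x ∈ gridBox (m + 1) N, ∑ σ : Equiv.Perm (Fin (m + 1)), (Equiv.Perm.sign σ : ℤ) *
      ∑ l : Fin (m + 2), (-1) ^ (l : ℕ) *
        Φ (fun k => freudenthalVertex x σ (l.succAbove k)) = 0 := by
  have hsplit : ∀ x : Fin (m + 1) → ℤ,
      ∑ σ : Equiv.Perm (Fin (m + 1)), (Equiv.Perm.sign σ : ℤ) *
        ∑ l : Fin (m + 2), (-1) ^ (l : ℕ) *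
          Φ (fun k => freudenthalVertex x σ (l.succAbove k)) =
      ∑ σ : Equiv.Perm (Fin (m + 1)), ((Equiv.Perm.sign σ : ℤ) *
          Φ (fun k => freudenthalVertex x σ k.succ) -
        (Equiv.Perm.sign σ : ℤ) *
          Φ (fun k => freudenthalVertex (x - Pi.single (σ.symm 0) 1) σ k.succ)) := by
    intro x
    have hrot := Equiv.sum_comp (Equiv.mulLeft (finRotate (m + 1)).symm)
      fun σ : Equiv.Perm (Fin (m + 1)) =>
        (Equiv.Perm.sign σ : ℤ) * Φ (fun k => freudenthalVertex x σ k.castSucc)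
    simp only [Equiv.coe_mulLeft, freudenthalVertex_rotate, Equiv.Perm.sign_mul,
      Equiv.Perm.sign_symm, sign_finRotate] at hrot
    have hmid : ∑ σ : Equiv.Perm (Fin (m + 1)), ∑ l : Fin m,
        (Equiv.Perm.sign σ : ℤ) * ((-1) ^ ((l.castSucc.succ : Fin (m + 2)) : ℕ) *
          Φ (fun k => freudenthalVertex x σ (l.castSucc.succ.succAbove k))) = 0 := by
      rw [Finset.sum_comm]
      refine Finset.sum_eq_zero fun l _ => ?_
      simp only [mul_left_comm _ ((-1 : ℤ) ^ _), ← Finset.mul_sum]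
      rw [sum_sign_inner_facet_eq_zero, mul_zero]
    have hlast : ∑ σ : Equiv.Perm (Fin (m + 1)), (Equiv.Perm.sign σ : ℤ) *
        ((-1) ^ (m + 1) * Φ (fun k => freudenthalVertex x σ k.castSucc)) =
        -∑ σ : Equiv.Perm (Fin (m + 1)), (Equiv.Perm.sign σ : ℤ) *
          Φ (fun k => freudenthalVertex (x - Pi.single (σ.symm 0) 1) σ k.succ) := by
      simp only [mul_left_comm _ ((-1 : ℤ) ^ _), ← Finset.mul_sum]
      rw [← hrot]
      push_cast
      simp only [mul_assoc, ← Finset.mul_sum]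
      rw [← mul_assoc, ← pow_add, show m + 1 + m = 2 * m + 1 by ring, pow_succ, pow_mul]
      simp
    simp only [Finset.mul_sum]
    simp only [Fin.sum_univ_succ (n := m + 1), Fin.sum_univ_castSucc (n := m),
      Finset.sum_add_distrib, hmid, Fin.succ_last, Fin.succAbove_last, Fin.val_last,
      Fin.zero_succAbove, Finset.sum_sub_distrib, hlast]
    simp
    ring
  simp only [hsplit]
  rw [Finset.sum_comm]
  refine Finset.sum_eq_zero fun σ _ => ?_
  rw [Finset.sum_sub_distrib, sub_eq_zero]
  refine (sum_gridBox_sub_single (σ.symm 0) (fun x => (Equiv.Perm.sign σ : ℤ) *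
    Φ (fun k => freudenthalVertex x σ k.succ)) ?_ ?_).symm
  · intro x hx
    rw [hΦ _ (σ.symm 0) (Or.inl fun l => by simp [freudenthalVertex, hx]), mul_zero]
  · intro x hx
    rw [hΦ _ (σ.symm 0) (Or.inr fun l => by simp [freudenthalVertex, hx]), mul_zero]

lemma det_eq_zero_of_column_const {n : ℕ} (A : Matrix (Fin n) (Fin n) ℤ) {p q : Fin n}
    (hpq : p ≠ q) (c : ℤ) (hp : ∀ l, A l p = 1) (hq : ∀ l, A l q = c) : A.det = 0 := by
  rw [← Matrix.det_updateCol_add_smul_self A hpq.symm (-c)]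
  refine Matrix.det_eq_zero_of_column_eq_zero q fun l => ?_
  simp [hp, hq]

/-- The rows are the values of `(1, g)` at the points `y l`; the determinant is `n!` times the
signed volume of the simplex with vertices `g (y l)`. -/
def simplexMatrix {n : ℕ} {X : Type*} (g : Fin n → X → ℤ) (y : Fin (n + 1) → X) :
    Matrix (Fin (n + 1)) (Fin (n + 1)) ℤ :=
  Matrix.of fun l => Fin.cons 1 fun k => g k (y l)

/-- The sum of the signed volumes of the images under `g` of the simplices triangulating the cube
`[0, N]ⁿ`. -/
noncomputable def totalDet {n : ℕ} (N : ℕ) (g : Fin n → (Fin n → ℤ) → ℤ) : ℤ :=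
  ∑ x ∈ gridBox n N, ∑ σ : Equiv.Perm (Fin n), (Equiv.Perm.sign σ : ℤ) *
    (simplexMatrix g (freudenthalVertex x σ)).det

/-- `g` agrees with the identity in the `k`-th component on the two faces `x k = 0`, `x k = N`. -/
def FaceCompatible {n : ℕ} (N : ℕ) (g : Fin n → (Fin n → ℤ) → ℤ) : Prop :=
  ∀ k x, (x k = 0 → g k x = 0) ∧ (x k = N → g k x = N)

lemma simplexMatrix_update {n : ℕ} {X : Type*} (g : Fin n → X → ℤ) (i : Fin n) (w : X → ℤ)
    (y : Fin (n + 1) → X) :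
    simplexMatrix (Function.update g i w) y =
      (simplexMatrix g y).updateCol i.succ (fun l => w (y l)) := by
  ext l c
  refine Fin.cases ?_ (fun k => ?_) c
  · rw [Matrix.updateCol_ne (Fin.succ_ne_zero i).symm]
    simp [simplexMatrix]
  · rcases eq_or_ne k i with rfl | hk
    · simp [simplexMatrix]
    · rw [Matrix.updateCol_ne (by simpa using hk)]
      simp [simplexMatrix, hk]

lemma det_simplexMatrix_update {n : ℕ} {X : Type*} (g : Fin n → X → ℤ) (i : Fin n) (u : X → ℤ)
    (y : Fin (n + 1) → X) :
    (simplexMatrix (Function.update g i u) y).det = ∑ l : Fin (n + 1), (-1) ^ (l : ℕ) *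
      ((-1) ^ (i : ℕ) * (∑ k, u (y (l.succAbove k))) *
        ((simplexMatrix g y).submatrix l.succAbove i.succ.succAbove).det) := by
  rw [simplexMatrix_update, ← Matrix.det_updateCol_add_smul_self _ (Fin.succ_ne_zero i)
    (-∑ l, u (y l)), Matrix.det_succ_column _ i.succ]
  refine Finset.sum_congr rfl fun l _ => ?_
  rw [Matrix.submatrix_updateCol_succAbove, Matrix.submatrix_updateCol_succAbove,
    Fin.sum_univ_succAbove _ l]
  have h0 : ((simplexMatrix g y).updateCol i.succ fun l => u (y l)) l 0 = 1 := by
    rw [Matrix.updateCol_ne (Fin.succ_ne_zero i).symm]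
    simp [simplexMatrix]
  simp only [Matrix.updateCol_self, smul_eq_mul, h0, Fin.val_succ]
  ring

lemma totalDet_update {n N : ℕ} (g : Fin n → (Fin n → ℤ) → ℤ) (hg : FaceCompatible N g)
    (i : Fin n) (w : (Fin n → ℤ) → ℤ) (hw : FaceCompatible N (Function.update g i w)) :
    totalDet N (Function.update g i w) = totalDet N g := by
  obtain _ | m := n
  · exact i.elim0
  rw [← sub_eq_zero]
  set u : (Fin (m + 1) → ℤ) → ℤ := w - g i with hu
  have hdiff : ∀ y, (simplexMatrix (Function.update g i w) y).det - (simplexMatrix g y).det =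
      (simplexMatrix (Function.update g i u) y).det := by
    intro y
    have h1 : (fun l => w (y l)) = (fun l => u (y l)) + fun l => g i (y l) := by
      ext l; simp [hu]
    rw [simplexMatrix_update, h1, Matrix.det_updateCol_add, ← simplexMatrix_update,
      ← simplexMatrix_update, Function.update_eq_self, add_sub_cancel_right]
  have hu0 : ∀ x : Fin (m + 1) → ℤ, x i = 0 ∨ x i = N → u x = 0 := by
    intro x hx
    have h1 := hg i x
    have h2 := hw i x
    rw [Function.update_self] at h2
    rcases hx with hx | hx
    · simp [hu, h1.1 hx, h2.1 hx]
    · simp [hu, h1.2 hx, h2.2 hx]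
  unfold totalDet
  simp only [← Finset.sum_sub_distrib, ← mul_sub, hdiff]
  simp only [det_simplexMatrix_update]
  refine sum_coboundary_eq_zero (fun y => (-1) ^ (i : ℕ) * (∑ k, u (y k)) *
    (Matrix.of fun l c => (Fin.cons 1 fun k => g k (y l) : Fin (m + 2) → ℤ)
      (i.succ.succAbove c)).det) fun y j hy => ?_
  rcases eq_or_ne j i with rfl | hji
  · have : ∀ k, u (y k) = 0 := fun k => hu0 _ (hy.imp (· k) (· k))
    simp [this]
  · obtain ⟨p, hp⟩ := Fin.exists_succAbove_eq (Fin.succ_ne_zero i).symm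
    obtain ⟨q, hq⟩ := Fin.exists_succAbove_eq (x := j.succ) (y := i.succ) (by simpa using hji)
    have hpq : p ≠ q := by
      rintro rfl
      exact Fin.succ_ne_zero j (hq.symm.trans hp)
    obtain ⟨c, hc⟩ : ∃ c, ∀ l, g j (y l) = c := by
      rcases hy with hy | hy
      · exact ⟨0, fun l => (hg j _).1 (hy l)⟩
      · exact ⟨N, fun l => (hg j _).2 (hy l)⟩
    rw [det_eq_zero_of_column_const _ hpq c (by simp [hp]) (by simp [hq, hc]), mul_zero]

lemma totalDet_congr {n N : ℕ} {g g' : Fin n → (Fin n → ℤ) → ℤ} (hg : FaceCompatible N g)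
    (hg' : FaceCompatible N g') : totalDet N g = totalDet N g' := by
  classical
  have hpw : ∀ S : Finset (Fin n), FaceCompatible N (S.piecewise g g') := by
    intro S k x
    by_cases hk : k ∈ S
    · simpa [hk] using hg k x
    · simpa [hk] using hg' k x
  have key : ∀ S : Finset (Fin n), totalDet N (S.piecewise g g') = totalDet N g' := by
    intro S
    induction S using Finset.induction_on with
    | empty => simp
    | insert a S _ ih =>
      have h := hpw (insert a S)
      rw [Finset.piecewise_insert] at h ⊢
      rw [totalDet_update _ (hpw S) a _ h, ih]
  simpa using key Finset.univ

lemma det_simplexMatrix_eval {n : ℕ} (x : Fin n → ℤ) (σ : Equiv.Perm (Fin n)) :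
    (simplexMatrix (fun k z => z k) (freudenthalVertex x σ)).det = Equiv.Perm.sign σ := by
  set T : Matrix (Fin (n + 1)) (Fin (n + 1)) ℤ := Matrix.of fun l c => if c ≤ l then 1 else 0
    with hT
  have hTdet : T.det = 1 := by
    rw [Matrix.det_of_isLowerTriangular T fun i j hij => by
      simpa [hT] using OrderDual.toDual_lt_toDual.1 hij]
    simp [hT]
  have hperm : (simplexMatrix (fun k z => z k) (freudenthalVertex x σ)).det =
      (T.submatrix id (Equiv.Perm.decomposeFin.symm (0, σ))).det := by
    rw [← Matrix.det_transpose, ← Matrix.det_transpose (T.submatrix _ _)]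
    refine Matrix.det_eq_of_forall_row_eq_smul_add_const (Fin.cons 0 x) 0 rfl fun c l => ?_
    simp only [Matrix.transpose_apply, Matrix.submatrix_apply, id_eq, simplexMatrix, hT,
      Matrix.of_apply]
    cases c using Fin.cases with
    | zero => simp
    | succ k => simp [freudenthalVertex, Fin.le_def, add_comm (x k)]
  rw [hperm, Matrix.det_permute', hTdet, Equiv.Perm.decomposeFin.symm_sign]
  simp

lemma totalDet_eval_pos {n N : ℕ} (hN : 0 < N) :
    0 < totalDet N (fun (k : Fin n) z => z k) := by
  unfold totalDet
  refine Finset.sum_pos (fun x _ => Finset.sum_pos (fun σ _ => ?_) Finset.univ_nonempty)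
    ⟨0, mem_gridBox.2 fun i => by simpa using hN⟩
  rw [det_simplexMatrix_eval, ← Units.val_mul, Int.units_mul_self]
  simp

lemma exists_cell_all_labels_fin {n N : ℕ} (hN : 0 < N) (g : Fin n → (Fin n → ℤ) → ℤ)
    (hg : FaceCompatible N g) (hval : ∀ k x, g k x = 0 ∨ g k x = N) :
    ∃ x : Fin n → ℤ, (∀ i, 0 ≤ x i ∧ x i < N) ∧ ∀ k,
      (∃ a, x ≤ a ∧ a ≤ x + 1 ∧ g k a = 0) ∧ (∃ b, x ≤ b ∧ b ≤ x + 1 ∧ g k b = N) := by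
  have hpos : totalDet N g ≠ 0 := by
    rw [totalDet_congr hg (g' := fun k z => z k) fun k x => ⟨id, id⟩]
    exact (totalDet_eval_pos hN).ne'
  obtain ⟨x, hx, hne⟩ := Finset.exists_ne_zero_of_sum_ne_zero hpos
  obtain ⟨σ, _, hne⟩ := Finset.exists_ne_zero_of_sum_ne_zero hne
  have hdet := right_ne_zero_of_mul hne
  have hcol : ∀ k c, ¬ ∀ l, g k (freudenthalVertex x σ l) = c := fun k c hc =>
    hdet (det_eq_zero_of_column_const _ (Fin.succ_ne_zero k).symm c (by simp [simplexMatrix])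
      (by simpa [simplexMatrix] using hc))
  have hle : ∀ l, x ≤ freudenthalVertex x σ l ∧ freudenthalVertex x σ l ≤ x + 1 := by
    refine fun l => ⟨fun i => ?_, fun i => ?_⟩ <;>
      simp only [freudenthalVertex, Pi.add_apply, Pi.one_apply] <;> split_ifs <;> simp
  refine ⟨x, mem_gridBox.1 hx, fun k => ⟨?_, ?_⟩⟩
  · obtain ⟨l, hl⟩ := not_forall.1 (hcol k N)
    exact ⟨_, (hle l).1, (hle l).2, (hval k _).resolve_right hl⟩
  · obtain ⟨l, hl⟩ := not_forall.1 (hcol k 0)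
    exact ⟨_, (hle l).1, (hle l).2, (hval k _).resolve_left hl⟩

/-- A cubical Sperner lemma: if `g k` takes the values `0` and `N` only, is `0` where `x k = 0`,
and `N` where `x k = N`, then on some unit cell of `[0, N]^M` every `g k` takes both values. -/
lemma exists_cell_all_labels {M : Type*} [Fintype M] {N : ℕ} (hN : 0 < N)
    (g : M → (M → ℤ) → ℤ) (hg : ∀ k x, (x k = 0 → g k x = 0) ∧ (x k = N → g k x = N))
    (hval : ∀ k x, g k x = 0 ∨ g k x = N) :
    ∃ x : M → ℤ, (∀ i, 0 ≤ x i ∧ x i < N) ∧ ∀ k,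
      (∃ a, x ≤ a ∧ a ≤ x + 1 ∧ g k a = 0) ∧ (∃ b, x ≤ b ∧ b ≤ x + 1 ∧ g k b = N) := by
  let e := Fintype.equivFin M
  obtain ⟨x, hx, h⟩ := exists_cell_all_labels_fin hN (fun k z => g (e.symm k) (z ∘ e))
    (fun k z => by simpa using hg (e.symm k) (z ∘ e)) (fun k z => hval _ _)
  refine ⟨x ∘ e, fun i => hx (e i), fun k => ?_⟩
  obtain ⟨⟨a, ha, ha', hga⟩, b, hb, hb', hgb⟩ := h (e k)
  rw [e.symm_apply_apply] at hga hgb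
  exact ⟨⟨a ∘ e, fun i => ha (e i), fun i => ha' (e i), hga⟩,
    b ∘ e, fun i => hb (e i), fun i => hb' (e i), hgb⟩

lemma exists_approx_sign_change {M : Type*} [Fintype M] {α β : M → ℝ} (hαβ : α ≤ β)
    (f : M → (M → ℝ) → ℝ)
    (hα : ∀ m, ∀ θ ∈ Set.Icc α β, θ m = α m → 0 ≤ f m θ)
    (hβ : ∀ m, ∀ θ ∈ Set.Icc α β, θ m = β m → f m θ ≤ 0) {N : ℕ} (hN : 0 < N) :
    ∃ p ∈ Set.Icc α β, ∀ m,
      (∃ a ∈ Set.Icc α β, dist a p ≤ dist β α / N ∧ 0 ≤ f m a) ∧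
      (∃ b ∈ Set.Icc α β, dist b p ≤ dist β α / N ∧ f m b ≤ 0) := by
  classical
  have hN' : (0 : ℝ) < N := by exact_mod_cast hN
  set P : (M → ℤ) → M → ℝ := fun x i => α i + x i / N * (β i - α i) with hP
  have hPmem : ∀ x : M → ℤ, (∀ i, 0 ≤ x i ∧ x i ≤ N) → P x ∈ Set.Icc α β := by
    intro x hx
    refine ⟨fun i => ?_, fun i => ?_⟩
    · have h0 : (0 : ℝ) ≤ x i := by exact_mod_cast (hx i).1
      have := mul_nonneg (div_nonneg h0 hN'.le) (sub_nonneg.2 (hαβ i))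
      simp only [hP]; linarith
    · have h0 : (x i : ℝ) / N ≤ 1 := (div_le_one hN').2 (by exact_mod_cast (hx i).2)
      have := mul_le_mul_of_nonneg_right h0 (sub_nonneg.2 (hαβ i))
      simp only [hP]; linarith
  have hPdist : ∀ x a : M → ℤ, x ≤ a → a ≤ x + 1 → dist (P a) (P x) ≤ dist β α / N := by
    intro x a hxa hax
    refine (dist_pi_le_iff (by positivity)).2 fun i => ?_
    have h1 : (x i : ℝ) ≤ a i := by exact_mod_cast hxa i
    have h2 : (a i : ℝ) ≤ x i + 1 := by exact_mod_cast hax i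
    have h3 : P a i - P x i = ((a i : ℝ) - x i) * ((β i - α i) / N) := by simp only [hP]; ring
    rw [Real.dist_eq, h3, abs_mul, abs_of_nonneg (sub_nonneg.2 h1), abs_div, abs_of_pos hN',
      ← Real.dist_eq]
    calc _ ≤ 1 * (dist (β i) (α i) / N) := by gcongr; linarith
      _ ≤ _ := by rw [one_mul]; gcongr; exact dist_le_pi_dist β α i
  set g : M → (M → ℤ) → ℤ := fun k x =>
    if x k = N ∨ (x k ≠ 0 ∧ f k (P x) ≤ 0) then N else 0 with hg
  have hN0 : (N : ℤ) ≠ 0 := by exact_mod_cast hN.ne'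
  obtain ⟨x, hx, h⟩ := exists_cell_all_labels hN g
    (fun k x => ⟨fun hk => by simp [hg, hk, hN0.symm], fun hk => by simp [hg, hk]⟩)
    (fun k x => by simp only [hg]; split_ifs <;> simp)
  have hbox : ∀ a, x ≤ a → a ≤ x + 1 → P a ∈ Set.Icc α β := fun a h1 h2 =>
    hPmem a fun i => ⟨(hx i).1.trans (h1 i), (h2 i).trans (Int.add_one_le_iff.2 (hx i).2)⟩
  refine ⟨P x, hPmem x fun i => ⟨(hx i).1, (hx i).2.le⟩, fun k => ?_⟩
  obtain ⟨⟨a, ha, ha', hga⟩, b, hb, hb', hgb⟩ := h k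
  refine ⟨⟨P a, hbox a ha ha', hPdist x a ha ha', ?_⟩, P b, hbox b hb hb', hPdist x b hb hb', ?_⟩
  · have h1 : ¬ (a k = N ∨ (a k ≠ 0 ∧ f k (P a) ≤ 0)) := fun h' =>
      hN0 (by simpa [hg, h'] using hga)
    rw [not_or, not_and, not_le] at h1
    by_cases h0 : a k = 0
    · exact hα k _ (hbox a ha ha') (by simp [hP, h0])
    · exact (h1.2 h0).le
  · have h1 : b k = N ∨ (b k ≠ 0 ∧ f k (P b) ≤ 0) := by
      by_contra h'
      exact hN0 (by simpa [hg, h'] using hgb.symm)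
    rcases h1 with h1 | h1
    · exact hβ k _ (hbox b hb hb') (by simp [hP, h1, hN'.ne'])
    · exact h1.2

/-- The **Poincaré–Miranda theorem**. -/
theorem poincare_miranda {M : Type*} [Fintype M] {α β : M → ℝ} (hαβ : α ≤ β)
    (f : M → (M → ℝ) → ℝ) (hf : ∀ m, ContinuousOn (f m) (Set.Icc α β))
    (hα : ∀ m, ∀ θ ∈ Set.Icc α β, θ m = α m → 0 ≤ f m θ)
    (hβ : ∀ m, ∀ θ ∈ Set.Icc α β, θ m = β m → f m θ ≤ 0) :
    ∃ θ ∈ Set.Icc α β, ∀ m, f m θ = 0 := by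
  choose p hp h using fun N : ℕ => exists_approx_sign_change hαβ f hα hβ N.succ_pos
  obtain ⟨θ, hθ, φ, hφ, hlim⟩ := isCompact_Icc.tendsto_subseq hp
  have hsmall : Filter.Tendsto (fun N : ℕ => dist β α / ((φ N).succ : ℕ)) Filter.atTop (nhds 0) :=
    ((tendsto_const_div_atTop_nhds_zero_nat (dist β α)).comp
      (Filter.tendsto_add_atTop_nat 1)).comp hφ.tendsto_atTop
  have hconv : ∀ m (a : ℕ → M → ℝ), (∀ N, a N ∈ Set.Icc α β) →
      (∀ N, dist (a N) (p N) ≤ dist β α / (N.succ : ℕ)) →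
      Filter.Tendsto (fun N => f m (a (φ N))) Filter.atTop (nhds (f m θ)) := by
    intro m a ha hd
    have hdist : Filter.Tendsto (fun N => dist (p (φ N)) (a (φ N))) Filter.atTop (nhds 0) :=
      squeeze_zero (fun _ => dist_nonneg) (fun N => by rw [dist_comm]; exact hd (φ N)) hsmall
    exact (hf m θ hθ).tendsto.comp (tendsto_nhdsWithin_iff.2
      ⟨(tendsto_iff_of_dist hdist).1 hlim, Filter.Eventually.of_forall fun N => ha (φ N)⟩)
  refine ⟨θ, hθ, fun m => ?_⟩
  choose a ha hda hfa using fun N => (h N m).1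
  choose b hb hdb hfb using fun N => (h N m).2
  exact le_antisymm (le_of_tendsto' (hconv m b hb hdb) fun N => hfb (φ N))
    (ge_of_tendsto' (hconv m a ha hda) fun N => hfa (φ N))

/-- **Theorem 1 of the paper.** On a closed rectangle `D = Π_m [α m, β m] ⊆ ℝ^M`, if each
feature-mean function `η m` is continuous on `D`, bounded below by `A m` on the face
`{θ ∈ D : θ m = α m}` and bounded above by `B m` on the face `{θ ∈ D : θ m = β m}`, then for
every target `μ` with `B m − β m / Λ m ≤ μ m ≤ A m − α m / Λ m` for all `m`, the fixed-point
equation `θ m = Λ m * (η m θ − μ m)` has a solution `θ ∈ D`. -/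
theorem exists_fixed_point_on_rectangle
    (M : Type*) [Fintype M]
    (α β : M → ℝ) (hαβ : ∀ m, α m ≤ β m)
    (η : M → (M → ℝ) → ℝ)
    (hη : ∀ m, ContinuousOn (η m) (Set.Icc α β))
    (Λ : M → ℝ) (hΛ : ∀ m, 0 < Λ m)
    (A B : M → ℝ)
    (hA : ∀ m, ∀ θ ∈ Set.Icc α β, θ m = α m → A m ≤ η m θ)
    (hB : ∀ m, ∀ θ ∈ Set.Icc α β, θ m = β m → η m θ ≤ B m)
    (μ : M → ℝ)
    (hμ : ∀ m, B m - β m / Λ m ≤ μ m ∧ μ m ≤ A m - α m / Λ m) :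
    ∃ θ ∈ Set.Icc α β, ∀ m, θ m = Λ m * (η m θ - μ m) := by
  obtain ⟨θ, hθ, h⟩ := poincare_miranda hαβ (fun m θ => Λ m * (η m θ - μ m) - θ m)
    (fun m => (continuousOn_const.mul ((hη m).sub continuousOn_const)).sub
      (continuous_apply m).continuousOn)
    (fun m θ hθ hm => by
      have h1 : α m / Λ m ≤ η m θ - μ m := by linarith [hA m θ hθ hm, (hμ m).2]
      rw [div_le_iff₀' (hΛ m)] at h1
      linarith)
    (fun m θ hθ hm => by
      have h1 : η m θ - μ m ≤ β m / Λ m := by linarith [hB m θ hθ hm, (hμ m).1]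
      rw [le_div_iff₀' (hΛ m)] at h1
      linarith)
  exact ⟨θ, hθ, fun m => (sub_eq_zero.1 (h m)).symm⟩
end

section
/- Let M be a finite index set and for each m ∈ M let η_m : ℝ^M → ℝ be continuous. Suppose that for each m ∈ M there exist Ā_m, B̄_m ∈ ℝ such that Ā_m ≤ η_m(θ) ≤ B̄_m for all θ ∈ ℝ^M. Then for every μ ∈ ℝ^M and every choice of Λ_m > 0 (m ∈ M), there exists θ ∈ ℝ^M such that θ_m = Λ_m(η_m(θ) − μ_m) for every m ∈ M. -/
open MeasureTheory Metric Set Function Filter Topology Polynomial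
open scoped NNReal

/-- A perturbation of the identity by a contraction is bijective. -/
theorem LipschitzWith.bijective_id_add {E : Type*} [NormedAddCommGroup E] [CompleteSpace E]
    {u : E → E} {K : ℝ≥0} (hu : LipschitzWith K u) (hK : K < 1) :
    Bijective fun x => x + u x := by
  have hc (y : E) : ContractingWith K fun x => y - u x :=
    ⟨hK, LipschitzWith.of_dist_le_mul fun a b => by
      rw [dist_sub_left]; exact hu.dist_le_mul a b⟩
  refine ⟨fun a b hab => ?_, fun y => ?_⟩
  · exact (hc (a + u a)).fixedPoint_unique' (by simp [IsFixedPt])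
      (by simp only at hab; simp [IsFixedPt, hab])
  · exact ⟨_, eq_sub_iff_add_eq.mp (hc y).fixedPoint_isFixedPt.symm⟩

/-- A function which is Lipschitz on a closed ball and vanishes on its boundary stays Lipschitz
when it is extended by zero. -/
theorem LipschitzOnWith.indicator_closedBall {E F : Type*} [NormedAddCommGroup E]
    [NormedSpace ℝ E] [NormedAddCommGroup F] {u : E → F} {K : ℝ≥0} {R : ℝ}
    (hu : LipschitzOnWith K u (closedBall 0 R)) (h0 : ∀ x, ‖x‖ = R → u x = 0) :
    LipschitzWith K ((closedBall 0 R).indicator u) := by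
  have key (x y : E) (hx : x ∈ closedBall (0 : E) R) (hy : y ∉ closedBall (0 : E) R) :
      ‖u x‖ ≤ K * dist x y := by
    have hx' : ‖x‖ ≤ R := by simpa using hx
    have hy' : R ≤ ‖y‖ := by simpa using (not_le.mp (by simpa using hy)).le
    obtain ⟨s, hs, hsR⟩ := intermediate_value_Icc (zero_le_one' ℝ)
      (f := fun s : ℝ => ‖AffineMap.lineMap x y s‖) (by fun_prop)
      ⟨by simpa using hx', by simpa using hy'⟩
    have h := hu.dist_le_mul x hx (AffineMap.lineMap x y s) (by simpa using hsR.le)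
    rw [h0 _ hsR, dist_zero_right, dist_left_lineMap, Real.norm_of_nonneg hs.1] at h
    exact h.trans (by gcongr; exact mul_le_of_le_one_left dist_nonneg hs.2)
  refine LipschitzWith.of_dist_le_mul fun x y => ?_
  by_cases hx : x ∈ closedBall (0 : E) R <;> by_cases hy : y ∈ closedBall (0 : E) R
  · simpa only [indicator_of_mem hx, indicator_of_mem hy] using hu.dist_le_mul x hx y hy
  · simpa [indicator_of_mem hx, indicator_of_notMem hy] using key x y hx hy
  · simpa [indicator_of_notMem hx, indicator_of_mem hy, dist_comm x y] using key y x hy hx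
  · simp only [indicator_of_notMem hx, indicator_of_notMem hy, dist_self]
    positivity

section FiniteDimensional

variable {E : Type*} [NormedAddCommGroup E] [NormedSpace ℝ E] [FiniteDimensional ℝ E]

theorem ContinuousLinearMap.det_one_add_ne_zero {A : E →L[ℝ] E} (hA : ‖A‖ < 1) :
    (1 + A).det ≠ 0 := by
  intro h
  refine LinearMap.det_eq_zero_iff_ker_ne_bot.mp h (LinearMap.ker_eq_bot'.mpr fun v hv => ?_)
  have hv' : v = -A v := eq_neg_of_add_eq_zero_left hv
  by_contra hne
  have h1 : ‖v‖ ≤ ‖A‖ * ‖v‖ := by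
    conv_lhs => rw [hv', norm_neg]
    exact A.le_opNorm v
  nlinarith [norm_pos_iff.mpr hne]

theorem ContinuousLinearMap.det_one_add_pos {A : E →L[ℝ] E} (hA : ‖A‖ < 1) :
    0 < (1 + A).det := by
  by_contra! h
  obtain ⟨s, hs, h0⟩ := intermediate_value_Icc' (zero_le_one' ℝ)
    (f := fun s : ℝ => (1 + s • A).det)
    (ContinuousLinearMap.continuous_det.comp (by fun_prop)).continuousOn
    ⟨by simpa using h, by simp [ContinuousLinearMap.det]⟩
  refine ContinuousLinearMap.det_one_add_ne_zero ?_ h0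
  rw [norm_smul, Real.norm_of_nonneg hs.1]
  exact (mul_le_of_le_one_left (norm_nonneg _) hs.2).trans_lt hA

variable [MeasurableSpace E] [BorelSpace E] (μ : Measure E) [μ.IsAddHaarMeasure]

/-- The integral of `det (1 + t A)` over a ball depends polynomially on `t`. -/
theorem exists_polynomial_integral_det_one_add_smul {A : E → E →L[ℝ] E} (hA : Continuous A)
    (R : ℝ) : ∃ p : ℝ[X], ∀ t : ℝ, ∫ x in ball 0 R, (1 + t • A x).det ∂μ = p.eval t := by
  let b := Module.finBasis ℝ E
  have hcont (i j) : Continuous fun x => LinearMap.toMatrix b b (A x : E →ₗ[ℝ] E) i j := by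
    simp only [LinearMap.toMatrix_apply]
    exact (LinearMap.continuous_of_finiteDimensional (b.coord i)).comp
      (hA.clm_apply continuous_const)
  let N : Matrix _ _ C(E, ℝ) := Matrix.of fun i j => ⟨_, hcont i j⟩
  let P : C(E, ℝ)[X] := Matrix.det (1 + (X : C(E, ℝ)[X]) • N.map C)
  let ev (x : E) : C(E, ℝ) →+* ℝ := (Pi.evalRingHom _ x).comp ContinuousMap.coeFnRingHom
  have hdet (t : ℝ) (x : E) :
      (1 + t • A x).det = ∑ i ∈ Finset.range (P.natDegree + 1), P.coeff i x * t ^ i := by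
    have h : P.eval₂ (ev x) t = (1 + t • A x).det := by
      rw [ContinuousLinearMap.det, ← LinearMap.det_toMatrix b, ← coe_eval₂RingHom, RingHom.map_det]
      congr 1
      ext i j
      by_cases hij : j = i <;>
        simp [N, ev, Matrix.one_apply, LinearMap.toMatrix_apply, Finsupp.single_apply, hij,
          eq_comm (a := i), mul_comm t]
    rw [← h, eval₂_eq_sum_range]
    rfl
  refine ⟨∑ i ∈ Finset.range (P.natDegree + 1),
    C (∫ x in ball 0 R, P.coeff i x ∂μ) * X ^ i, fun t => ?_⟩
  simp only [hdet, eval_finsetSum, eval_mul, eval_C, eval_pow, eval_X]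
  rw [integral_finsetSum]
  · simp only [integral_mul_const]
  · intro i _
    exact (((P.coeff i).continuous.continuousOn.integrableOn_compact
      (isCompact_closedBall 0 R)).mono_set ball_subset_closedBall).mul_const _

/-- If a `C¹` vector field vanishes on a sphere, adding it to the identity does not change the
signed volume of the ball. -/
theorem integral_ball_det_one_add_fderiv {u : E → E} (hu : ContDiff ℝ 1 u) {R : ℝ}
    (h0 : ∀ x, ‖x‖ = R → u x = 0) :
    ∫ x in ball 0 R, (1 + fderiv ℝ u x).det ∂μ = μ.real (ball 0 R) := by
  have : CompleteSpace E := FiniteDimensional.complete ℝ E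
  obtain ⟨K, hK⟩ := hu.contDiffOn.exists_lipschitzOnWith one_ne_zero
    (convex_closedBall 0 R) (isCompact_closedBall 0 R)
  set v := (closedBall (0 : E) R).indicator u with hv
  have hvL : LipschitzWith K v := hK.indicator_closedBall h0
  have hv0 (x : E) (hx : x ∉ ball (0 : E) R) : v x = 0 := by
    by_cases hx' : x ∈ closedBall (0 : E) R
    · rw [hv, indicator_of_mem hx']
      exact h0 x (le_antisymm (by simpa using hx') (by simpa using hx))
    · exact indicator_of_notMem hx' u
  have hvu : EqOn v u (ball 0 R) := fun x hx => indicator_of_mem (ball_subset_closedBall hx) u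
  obtain ⟨p, hp⟩ := exists_polynomial_integral_det_one_add_smul μ
    (hu.continuous_fderiv one_ne_zero) R
  have hsmall (t : ℝ) (ht : t ∈ Ioo 0 ((K : ℝ) + 1)⁻¹) : p.eval t = μ.real (ball 0 R) := by
    have htK : t * K < 1 := by
      have := (lt_inv_comm₀ ht.1 (by positivity)).mp ht.2
      have h2 := mul_lt_mul_of_pos_left this ht.1
      rw [mul_inv_cancel₀ ht.1.ne'] at h2
      nlinarith [ht.1]
    set h : E → E := fun x => x + t • v x with hh
    have hbij : Bijective h := by
      have hL : LipschitzWith (‖t‖₊ * K) fun x => t • v x := (lipschitzWith_smul t).comp hvL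
      refine hL.bijective_id_add ?_
      rw [← NNReal.coe_lt_coe]
      simpa [abs_of_pos ht.1] using htK
    have hfix (x : E) (hx : x ∉ ball (0 : E) R) : h x = x := by simp [hh, hv0 x hx]
    have himage : h '' ball 0 R = ball 0 R := by
      ext y
      refine ⟨?_, fun hy => ?_⟩
      · rintro ⟨x, hx, rfl⟩
        by_contra hn
        exact hn (by rwa [hbij.1 (hfix _ hn)])
      · obtain ⟨x, rfl⟩ := hbij.2 y
        refine ⟨x, ?_, rfl⟩
        by_contra hn
        exact hn (by rwa [hfix x hn] at hy)
    have hderiv : ∀ x ∈ ball (0 : E) R,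
        HasFDerivWithinAt h (1 + t • fderiv ℝ u x) (ball 0 R) x := fun x hx => by
      have h1 := ((hasFDerivAt_id x).add
        ((hu.differentiable one_ne_zero x).hasFDerivAt.const_smul t)).hasFDerivWithinAt
        (s := ball 0 R)
      exact h1.congr (fun y hy => by simp [hh, hvu hy]) (by simp [hh, hvu hx])
    have hcv := integral_image_eq_integral_abs_det_fderiv_smul μ measurableSet_ball hderiv
      hbij.1.injOn fun _ => (1 : ℝ)
    rw [himage] at hcv
    rw [← hp]
    simp only [integral_const, smul_eq_mul, mul_one, measureReal_restrict_apply_univ] at hcv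
    rw [hcv]
    refine setIntegral_congr_fun measurableSet_ball fun x hx => ?_
    refine (abs_of_pos (ContinuousLinearMap.det_one_add_pos ?_)).symm
    have hb := norm_fderiv_le_of_lipschitzOn ℝ (closedBall_mem_nhds_of_mem hx) hK
    rw [norm_smul, Real.norm_of_nonneg ht.1.le]
    exact (mul_le_mul_of_nonneg_left hb ht.1.le).trans_lt htK
  have hpC : p = C (μ.real (ball 0 R)) := by
    refine eq_of_infinite_eval_eq _ _ ((Ioo_infinite (a := (0 : ℝ)) (b := ((K : ℝ) + 1)⁻¹)
      (by positivity)).mono fun t ht => ?_)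
    simpa using hsmall t ht
  simpa [hpC] using hp 1

end FiniteDimensional

section Euclidean

variable {E : Type*} [NormedAddCommGroup E] [InnerProductSpace ℝ E] [FiniteDimensional ℝ E]

theorem det_fderiv_eq_zero_of_norm_eq {r : E → E} (hr : Differentiable ℝ r) {R : ℝ} (hR : 0 < R)
    (hnorm : ∀ x, ‖r x‖ = R) (x : E) : (fderiv ℝ r x).det = 0 := by
  by_contra hdet
  have hsurj : Surjective (fderiv ℝ r x) :=
    (LinearEquiv.ofIsUnitDet (v := Module.finBasis ℝ E) (v' := Module.finBasis ℝ E)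
      (f := (fderiv ℝ r x : E →ₗ[ℝ] E))
      (by rw [LinearMap.det_toMatrix]; exact isUnit_iff_ne_zero.mpr hdet)).surjective
  obtain ⟨w, hw⟩ := hsurj (r x)
  have h1 := (hr x).hasFDerivAt.norm_sq
  have h2 : HasFDerivAt (fun y => ‖r y‖ ^ 2) (0 : E →L[ℝ] ℝ) x := by
    simp only [hnorm]
    exact hasFDerivAt_const _ _
  have h3 := congrArg (fun L : E →L[ℝ] ℝ => L w) (h1.unique h2)
  simp [hw, hnorm, hR.ne'] at h3

/-- There is no `C¹` retraction onto a sphere. -/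
theorem not_exists_contDiff_retraction_sphere {R : ℝ} (hR : 0 < R) :
    ¬ ∃ r : E → E, ContDiff ℝ 1 r ∧ (∀ x, ‖r x‖ = R) ∧ ∀ x, ‖x‖ = R → r x = x := by
  rintro ⟨r, hr, hnorm, hid⟩
  borelize E
  have hd := hr.differentiable one_ne_zero
  have h := integral_ball_det_one_add_fderiv (volume : Measure E) (u := fun x => r x - x)
    (hr.sub contDiff_id) (R := R) fun x hx => by simp [hid x hx]
  have hfd (x : E) : 1 + fderiv ℝ (fun x => r x - x) x = fderiv ℝ r x := by
    rw [fderiv_fun_sub (hd x) differentiableAt_fun_id, fderiv_fun_id]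
    exact add_sub_cancel _ _
  simp only [hfd, det_fderiv_eq_zero_of_norm_eq hd hR hnorm, integral_zero] at h
  exact (ENNReal.toReal_pos (measure_ball_pos _ _ hR).ne' measure_ball_lt_top.ne).ne h

theorem ContDiff.exists_isFixedPt_of_support_subset_ball {g : E → E} (hg : ContDiff ℝ 1 g)
    {R : ℝ} (hR : 0 < R) (hsupp : support g ⊆ ball 0 R) : ∃ x, IsFixedPt g x := by
  by_contra! hfix
  have hne (x : E) : x - g x ≠ 0 := fun h => hfix x (sub_eq_zero.mp h).symm
  have hpos (x : E) : ‖x - g x‖ ≠ 0 := norm_ne_zero_iff.mpr (hne x)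
  refine not_exists_contDiff_retraction_sphere (E := E) hR
    ⟨fun x => (R / ‖x - g x‖) • (x - g x), ?_, fun x => ?_, fun x hx => ?_⟩
  · have hF : ContDiff ℝ 1 fun x => x - g x := contDiff_id.sub hg
    exact (contDiff_const.div (hF.norm ℝ hne) hpos).smul hF
  · rw [norm_smul, norm_div, norm_norm, Real.norm_of_nonneg hR.le, div_mul_cancel₀ _ (hpos x)]
  · have : g x = 0 := by
      by_contra hx0
      have := hsupp hx0
      simp [hx] at this
    simp [this, hx, hR.ne']

/-- A bounded continuous self-map of a finite-dimensional Euclidean space has a fixed point. -/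
theorem Continuous.exists_isFixedPt_of_bounded {f : E → E} (hf : Continuous f) {B : ℝ}
    (hB : ∀ x, ‖f x‖ ≤ B) : ∃ x, IsFixedPt f x := by
  have hB0 : 0 ≤ B := (norm_nonneg _).trans (hB 0)
  set c : E → ℝ := fun x => max 0 (min 1 (B + 1 - ‖x‖)) with hc
  have hc0 (x : E) : 0 ≤ c x := le_max_left _ _
  have hc1 (x : E) : c x ≤ 1 := max_le zero_le_one (min_le_left _ _)
  have hfc : Continuous fun x => c x • f x := by fun_prop
  have hsupp : support (fun x => c x • f x) ⊆ ball 0 (B + 1) := fun x hx => by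
    rw [mem_ball_zero_iff]
    by_contra! hn
    refine hx ?_
    have : c x = 0 := max_eq_left ((min_le_right _ _).trans (by linarith))
    simp [this]
  obtain ⟨z, -, hz⟩ := (isCompact_closedBall (0 : E) (B + 1)).exists_isMinOn
    ⟨0, by simp; positivity⟩ (f := fun x => dist x (c x • f x)) (by fun_prop)
  by_cases hzero : dist z (c z • f z) = 0
  · have hz' : z = c z • f z := dist_eq_zero.mp hzero
    have hzB : ‖z‖ ≤ B := by
      rw [hz', norm_smul, Real.norm_of_nonneg (hc0 z)]
      exact (mul_le_of_le_one_left (norm_nonneg _) (hc1 z)).trans (hB z)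
    have : c z = 1 := by
      simp only [hc]
      rw [min_eq_left (by linarith), max_eq_right zero_le_one]
    exact ⟨z, by simpa [this, IsFixedPt] using hz'.symm⟩
  · exfalso
    obtain ⟨g, hg, hdist, hgs⟩ := hfc.exists_contDiff_approx 1
      (ε := fun _ => dist z (c z • f z)) continuous_const
      fun _ => lt_of_le_of_ne dist_nonneg (Ne.symm hzero)
    obtain ⟨x, hx⟩ := ContDiff.exists_isFixedPt_of_support_subset_ball (mod_cast hg)
      (show 0 < B + 1 by positivity) (hgs.trans hsupp)
    have hxB : x ∈ closedBall (0 : E) (B + 1) := by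
      by_cases h : g x = 0
      · rw [hx.eq] at h
        simp only [h, mem_closedBall_self (show 0 ≤ B + 1 by positivity)]
      · exact ball_subset_closedBall (hsupp (hgs h))
    have h1 := hdist x
    rw [hx.eq] at h1
    exact absurd (hz hxB) (not_le.mpr h1)

end Euclidean

/-- **Theorem 3 of the paper.** If the feature-mean functions `η m : ℝ^M → ℝ` are continuous
and globally bounded, then for every target vector `μ` and all positive weights `Λ m`, the
fixed-point equation `θ m = Λ m * (η m θ − μ m)` has a solution. -/
theorem exists_fixed_point_of_bounded
    (M : Type*) [Fintype M]
    (η : M → (M → ℝ) → ℝ) (hη : ∀ m, Continuous (η m))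
    (hbdd : ∀ m, ∃ Abar Bbar : ℝ, ∀ θ : M → ℝ, Abar ≤ η m θ ∧ η m θ ≤ Bbar)
    (μ : M → ℝ) (Λ : M → ℝ) (hΛ : ∀ m, 0 < Λ m) :
    ∃ θ : M → ℝ, ∀ m, θ m = Λ m * (η m θ - μ m) := by
  choose a b hab using hbdd
  let Φ : (M → ℝ) → M → ℝ := fun θ m => Λ m * (η m θ - μ m)
  have hΦ : Continuous Φ := by fun_prop
  obtain ⟨B, hB⟩ := ((isCompact_Icc (a := fun m => Λ m * (a m - μ m))
    (b := fun m => Λ m * (b m - μ m))).image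
      (PiLp.continuous_toLp 2 fun _ : M => ℝ)).isBounded.exists_norm_le
  obtain ⟨x, hx⟩ := Continuous.exists_isFixedPt_of_bounded
    (f := fun x : EuclideanSpace ℝ M => WithLp.toLp 2 (Φ x.ofLp)) (by fun_prop)
    fun x => hB _ ⟨Φ x.ofLp,
      ⟨fun m => mul_le_mul_of_nonneg_left (sub_le_sub_right (hab m _).1 _) (hΛ m).le,
        fun m => mul_le_mul_of_nonneg_left (sub_le_sub_right (hab m _).2 _) (hΛ m).le⟩, rfl⟩
  exact ⟨x.ofLp, fun m => (congrFun (congrArg WithLp.ofLp hx.eq) m).symm⟩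
end
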